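/- Let x be uniformly distributed on the unit sphere S^{d-1} ⊆ ℝ^d with d ≥ 3, and let 0 < b ≤ 1/(10√d). Then P[x₁ ∈ [b/2, b]] ≥ (√d/(8π))·b. -/

import Mathlib

open MeasureTheory

/-- The uniform (rotation-invariant) probability distribution on the unit sphere. -/
def IsUniformOnSphere {d : ℕ} (μ : Measure (EuclideanSpace ℝ (Fin d))) : Prop :=
  IsProbabilityMeasure μ ∧ μ {x | ‖x‖ = 1}ᶜ = 0 ∧
    ∀ f : EuclideanSpace ℝ (Fin d) ≃ₗᵢ[ℝ] EuclideanSpace ℝ (Fin d),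
      Measure.map (⇑f) μ = μ

open ProbabilityTheory Set Real
open scoped RealInnerProductSpace

/-- Averaging over a second rotation-invariant measure `γ` bounds the mass which a
rotation-invariant measure `μ` on the unit sphere gives to a slab. -/
lemma measure_cone_le_measure_slab {E : Type*} [NormedAddCommGroup E] [InnerProductSpace ℝ E]
    [FiniteDimensional ℝ E] [MeasurableSpace E] [BorelSpace E]
    (μ γ : Measure E) [IsProbabilityMeasure μ] [IsProbabilityMeasure γ]
    (hsphere : ∀ᵐ x ∂μ, ‖x‖ = 1)
    (hμ : ∀ f : E ≃ₗᵢ[ℝ] E, μ.map f = μ) (hγ : ∀ f : E ≃ₗᵢ[ℝ] E, γ.map f = γ)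
    {e : E} (he : ‖e‖ = 1) (a b : ℝ) :
    γ {y | 0 < ⟪e, y⟫ ∧ ⟪e, y⟫ ∈ Icc (a * ‖y‖) (b * ‖y‖)} ≤ μ {x | ⟪x, e⟫ ∈ Icc a b} := by
  set A : Set (E × E) := {p | 0 < ⟪p.1, p.2⟫ ∧ a * ‖p.2‖ ≤ ⟪p.1, p.2⟫ ∧ ⟪p.1, p.2⟫ ≤ b * ‖p.2‖}
    with hA
  have hAm : MeasurableSet A := by
    simp only [hA, ofPred_and]
    refine (measurableSet_lt ?_ ?_).inter ((measurableSet_le ?_ ?_).inter (measurableSet_le ?_ ?_)) <;>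
      fun_prop
  have hfst : μ.prod γ A = γ {y | 0 < ⟪e, y⟫ ∧ ⟪e, y⟫ ∈ Icc (a * ‖y‖) (b * ‖y‖)} := by
    rw [Measure.prod_apply hAm]
    have : ∀ᵐ x ∂μ, γ (Prod.mk x ⁻¹' A) = γ (Prod.mk e ⁻¹' A) := by
      filter_upwards [hsphere] with x hx
      set R := (ℝ ∙ (x - e))ᗮ.reflection
      have hR : R x = e := Submodule.reflection_sub (hx.trans he.symm)
      conv_rhs => rw [← hγ R]
      rw [Measure.map_apply R.continuous.measurable (measurable_prodMk_left hAm)]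
      congr 1
      ext y
      simp only [hA, mem_preimage, mem_ofPred_eq, ← hR, R.inner_map_map, R.norm_map]
    rw [lintegral_congr_ae this]
    simp [hA, preimage]
  rw [← hfst, Measure.prod_apply_symm hAm]
  have hslab : MeasurableSet {x : E | ⟪x, e⟫ ∈ Icc a b} :=
    measurableSet_Icc.preimage (f := fun x : E ↦ ⟪x, e⟫) (by fun_prop)
  have hle : ∀ y, μ ((fun x ↦ (x, y)) ⁻¹' A) ≤ μ {x | ⟪x, e⟫ ∈ Icc a b} := by
    intro y
    rcases eq_or_ne y 0 with rfl | hy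
    · simp [hA]
    have hy0 : 0 < ‖y‖ := norm_pos_iff.2 hy
    have hnorm : ‖(‖y‖⁻¹ • y)‖ = 1 := by
      rw [norm_smul, norm_inv, norm_norm, inv_mul_cancel₀ hy0.ne']
    set R := (ℝ ∙ (‖y‖⁻¹ • y - e))ᗮ.reflection
    have hR : R (‖y‖⁻¹ • y) = e := Submodule.reflection_sub (hnorm.trans he.symm)
    conv_rhs => rw [← hμ R]
    rw [Measure.map_apply R.continuous.measurable hslab]
    refine measure_mono fun x hx ↦ ?_
    obtain ⟨-, h1, h2⟩ := hx
    simp only [mem_preimage, mem_ofPred_eq, ← hR, R.inner_map_map, real_inner_smul_right, mem_Icc]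
    rw [inv_mul_eq_div, le_div_iff₀ hy0, div_le_iff₀ hy0]
    exact ⟨h1, h2⟩
  calc _ ≤ ∫⁻ _, μ {x | ⟪x, e⟫ ∈ Icc a b} ∂γ := lintegral_mono hle
    _ = _ := by simp

lemma integral_exp_neg_mul_sq_gaussianReal {c : ℝ} (hc : 0 ≤ c) :
    ∫ x, exp (-c * x ^ 2) ∂(gaussianReal 0 1) = (√(1 + 2 * c))⁻¹ := by
  rw [integral_gaussianReal_eq_integral_smul one_ne_zero]
  have h : ∀ x : ℝ, gaussianPDFReal 0 1 x • exp (-c * x ^ 2) =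
      (√(2 * π))⁻¹ * exp (-(c + 1 / 2) * x ^ 2) := by
    intro x
    simp only [gaussianPDFReal, NNReal.coe_one, mul_one, sub_zero, smul_eq_mul]
    rw [mul_assoc, ← exp_add]
    ring_nf
  simp_rw [h]
  rw [integral_const_mul, integral_gaussian, ← sqrt_inv, ← sqrt_mul (by positivity), ← sqrt_inv]
  congr 1
  have := pi_pos
  field_simp
  ring

lemma integral_exp_neg_mul_sum_sq_gaussian (n : ℕ) {c : ℝ} (hc : 0 ≤ c) :
    ∫ z : Fin n → ℝ, exp (-c * ∑ i, z i ^ 2) ∂(Measure.pi fun _ ↦ gaussianReal 0 1) =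
      (√(1 + 2 * c))⁻¹ ^ n := by
  simp_rw [Finset.mul_sum, exp_sum]
  rw [integral_fintype_prod_eq_prod (f := fun _ x ↦ exp (-c * x ^ 2))]
  simp [← integral_exp_neg_mul_sq_gaussianReal hc]

lemma integrable_exp_neg_mul_sum_sq_gaussian (n : ℕ) {c : ℝ} (hc : 0 ≤ c) :
    Integrable (fun z : Fin n → ℝ ↦ exp (-c * ∑ i, z i ^ 2))
      (Measure.pi fun _ ↦ gaussianReal 0 1) := by
  refine Integrable.of_bound (C := 1) (Measurable.aestronglyMeasurable (by fun_prop))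
    (ae_of_all _ fun z ↦ ?_)
  rw [norm_of_nonneg (exp_pos _).le, exp_le_one_iff]
  have : 0 ≤ ∑ i, z i ^ 2 := Finset.sum_nonneg fun i _ ↦ sq_nonneg _
  nlinarith

lemma le_gaussianReal_Icc {u v : ℝ} (hu : 0 ≤ u) :
    ENNReal.ofReal ((v - u) * ((√(2 * π))⁻¹ * exp (-v ^ 2 / 2))) ≤
      gaussianReal 0 1 (Icc u v) := by
  rw [gaussianReal_apply _ one_ne_zero]
  calc _ = ∫⁻ _ in Icc u v, ENNReal.ofReal ((√(2 * π))⁻¹ * exp (-v ^ 2 / 2)) := by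
        rw [setLIntegral_const, Real.volume_Icc, mul_comm, ENNReal.ofReal_mul (by positivity)]
    _ ≤ _ := by
        refine setLIntegral_mono (by fun_prop) fun x hx ↦ ENNReal.ofReal_le_ofReal ?_
        simp only [gaussianPDFReal, NNReal.coe_one, mul_one, sub_zero]
        have : x ^ 2 ≤ v ^ 2 := pow_le_pow_left₀ (hu.trans hx.1) hx.2 2
        gcongr

/-- A lower bound of `s` by a difference of Gaussians. -/
lemma sqrt_mul_one_sub_exp_le {k s : ℝ} (hk : 0 < k) (hs : 0 ≤ s) :
    √k * (1 - exp (-(1 / k) * s ^ 2)) ≤ s := by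
  have hk' : 0 < √k := sqrt_pos.2 hk
  have h1 := add_one_le_exp (-(1 / k) * s ^ 2)
  have h2 := exp_pos (-(1 / k) * s ^ 2)
  have hu : s = √k * (s / √k) := by field_simp
  have hu2 : (s / √k) ^ 2 = 1 / k * s ^ 2 := by rw [div_pow, sq_sqrt hk.le]; ring
  have hu0 : 0 ≤ s / √k := by positivity
  conv_rhs => rw [hu]
  gcongr
  rcases le_total (s / √k) 1 with h | h
  · nlinarith
  · linarith

lemma gaussian_cone_lower_bound (n : ℕ) (hn : 0 < n) {b : ℝ} (hb0 : 0 < b) (hb1 : b ≤ 1) :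
    ENNReal.ofReal (2 / 5 * b * (√(2 * π))⁻¹ * √n *
        ((√(1 + b ^ 2))⁻¹ ^ n - (√(1 + b ^ 2 + 2 / n))⁻¹ ^ n)) ≤
      stdGaussian (EuclideanSpace ℝ (Fin (n + 1)))
        {y | 0 < y 0 ∧ y 0 ∈ Icc (b / 2 * ‖y‖) (b * ‖y‖)} := by
  have hn' : (0 : ℝ) < n := by exact_mod_cast hn
  set g := gaussianReal 0 1
  set P : Measure (Fin n → ℝ) := Measure.pi fun _ ↦ g
  set S : (Fin n → ℝ) → ℝ := fun z ↦ √(∑ i, z i ^ 2)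
  have hSm : Measurable S := by fun_prop
  set D : Set (ℝ × (Fin n → ℝ)) :=
    {p | 0 < p.1 ∧ 3 / 5 * b * S p.2 ≤ p.1 ∧ p.1 ≤ b * S p.2} with hD
  have hDm : MeasurableSet D := by
    simp only [hD, ofPred_and]
    refine (measurableSet_lt ?_ ?_).inter ((measurableSet_le ?_ ?_).inter (measurableSet_le ?_ ?_)) <;>
      fun_prop
  have hcone : MeasurableSet
      {y : EuclideanSpace ℝ (Fin (n + 1)) | 0 < y 0 ∧ y 0 ∈ Icc (b / 2 * ‖y‖) (b * ‖y‖)} := by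
    simp only [mem_Icc, ofPred_and]
    refine (measurableSet_lt ?_ ?_).inter ((measurableSet_le ?_ ?_).inter (measurableSet_le ?_ ?_)) <;>
      fun_prop
  have hmp := measurePreserving_piFinSuccAbove (fun _ : Fin (n + 1) ↦ g) 0
  have hDle : (g.prod P) D ≤ stdGaussian (EuclideanSpace ℝ (Fin (n + 1)))
      {y | 0 < y 0 ∧ y 0 ∈ Icc (b / 2 * ‖y‖) (b * ‖y‖)} := by
    rw [← map_pi_eq_stdGaussian, Measure.map_apply (by fun_prop) hcone,
      ← hmp.measure_preimage hDm.nullMeasurableSet]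
    refine measure_mono fun y hy ↦ ?_
    obtain ⟨h0, h1, h2⟩ := hy
    simp only [MeasurableEquiv.piFinSuccAbove_apply, Fin.insertNthEquiv_zero,
      Fin.consEquiv_symm_apply] at h0 h1 h2
    set s := S (Fin.tail y)
    have hs0 : 0 ≤ s := sqrt_nonneg _
    have hnorm : ‖(WithLp.toLp 2 y : EuclideanSpace ℝ (Fin (n + 1)))‖ ^ 2 = y 0 ^ 2 + s ^ 2 := by
      rw [EuclideanSpace.real_norm_sq_eq, Fin.sum_univ_succ,
        sq_sqrt (Finset.sum_nonneg fun i _ ↦ sq_nonneg _)]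
      rfl
    set N := ‖(WithLp.toLp 2 y : EuclideanSpace ℝ (Fin (n + 1)))‖
    have hN : 0 ≤ N := norm_nonneg _
    refine ⟨h0, ?_, ?_⟩
    · refine (pow_le_pow_iff_left₀ (by positivity) h0.le two_ne_zero).1 ?_
      have h3 : (3 / 5 * b * s) ^ 2 ≤ y 0 ^ 2 := pow_le_pow_left₀ (by positivity) h1 2
      have h4 : b ^ 2 * y 0 ^ 2 ≤ 1 * y 0 ^ 2 := by
        gcongr
        exact pow_le_one₀ hb0.le hb1
      rw [mul_pow, hnorm]
      linarith [sq_nonneg (y 0)]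
    · refine h2.trans ?_
      gcongr
      nlinarith [sq_nonneg (y 0)]
  refine le_trans ?_ hDle
  rw [Measure.prod_apply_symm hDm]
  have hc1 : 0 ≤ b ^ 2 / 2 := by positivity
  have hc2 : 0 ≤ b ^ 2 / 2 + 1 / n := by positivity
  have hi1 := integrable_exp_neg_mul_sum_sq_gaussian n hc1
  have hi2 := integrable_exp_neg_mul_sum_sq_gaussian n hc2
  set f : (Fin n → ℝ) → ℝ := fun z ↦ 2 / 5 * b * (√(2 * π))⁻¹ * √n *
    (exp (-(b ^ 2 / 2) * ∑ i, z i ^ 2) - exp (-(b ^ 2 / 2 + 1 / n) * ∑ i, z i ^ 2)) with hf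
  have hint : ∫ z, f z ∂P = 2 / 5 * b * (√(2 * π))⁻¹ * √n *
        ((√(1 + b ^ 2))⁻¹ ^ n - (√(1 + b ^ 2 + 2 / n))⁻¹ ^ n) := by
    rw [hf, integral_const_mul, integral_sub hi1 hi2, integral_exp_neg_mul_sum_sq_gaussian n hc1,
      integral_exp_neg_mul_sum_sq_gaussian n hc2]
    ring_nf
  have hf0 : ∀ z, 0 ≤ f z := by
    intro z
    have hsum : 0 ≤ ∑ i, z i ^ 2 := Finset.sum_nonneg fun i _ ↦ sq_nonneg _
    refine mul_nonneg (by positivity) (sub_nonneg.2 (exp_le_exp.2 ?_))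
    gcongr
    simp
  have hfi : Integrable f P := (hi1.sub hi2).const_mul _
  rw [← hint, ofReal_integral_eq_lintegral_ofReal hfi (ae_of_all _ hf0)]
  refine lintegral_mono fun z ↦ ?_
  have hsum : 0 ≤ ∑ i, z i ^ 2 := Finset.sum_nonneg fun i _ ↦ sq_nonneg _
  have hsq : S z ^ 2 = ∑ i, z i ^ 2 := sq_sqrt hsum
  have hS0 : 0 ≤ S z := sqrt_nonneg _
  rcases hS0.eq_or_lt with h | h
  · have : f z = 0 := by simp [hf, ← hsq, ← h]
    simp [this]
  have hset : (fun u ↦ (u, z)) ⁻¹' D = Icc (3 / 5 * b * S z) (b * S z) := by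
    ext u
    simp only [hD, mem_preimage, mem_ofPred_eq, mem_Icc, and_iff_right_iff_imp]
    rintro ⟨h1, -⟩
    exact lt_of_lt_of_le (by positivity) h1
  rw [hset]
  refine le_trans (ENNReal.ofReal_le_ofReal ?_) (le_gaussianReal_Icc (by positivity))
  have hkey := sqrt_mul_one_sub_exp_le hn' h.le
  have hexp : exp (-(b ^ 2 / 2 + 1 / n) * ∑ i, z i ^ 2) =
      exp (-(b * S z) ^ 2 / 2) * exp (-(1 / n) * S z ^ 2) := by
    rw [← exp_add, ← hsq]; ring_nf
  have hexp' : exp (-(b ^ 2 / 2) * ∑ i, z i ^ 2) = exp (-(b * S z) ^ 2 / 2) := by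
    rw [← hsq]; ring_nf
  calc f z = 2 / 5 * b * (√(2 * π))⁻¹ * exp (-(b * S z) ^ 2 / 2) *
        (√n * (1 - exp (-(1 / n) * S z ^ 2))) := by simp only [hf, hexp, hexp']; ring
    _ ≤ 2 / 5 * b * (√(2 * π))⁻¹ * exp (-(b * S z) ^ 2 / 2) * S z := by gcongr
    _ = _ := by ring

lemma gaussian_cone_constant_bound (n : ℕ) (hn : 2 ≤ n) {b : ℝ} (hb0 : 0 < b)
    (hb : b ≤ 1 / (10 * √(n + 1 : ℝ))) :
    √(n + 1 : ℝ) / (8 * π) * b ≤ 2 / 5 * b * (√(2 * π))⁻¹ * √n *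
        ((√(1 + b ^ 2))⁻¹ ^ n - (√(1 + b ^ 2 + 2 / n))⁻¹ ^ n) := by
  have hn' : (2 : ℝ) ≤ n := by exact_mod_cast hn
  have hb2 : n * b ^ 2 ≤ 1 / 100 := by
    have h1 : b ^ 2 ≤ (1 / (10 * √(n + 1 : ℝ))) ^ 2 := pow_le_pow_left₀ hb0.le hb 2
    rw [div_pow, mul_pow, sq_sqrt (by positivity)] at h1
    calc n * b ^ 2 ≤ n * (1 ^ 2 / (10 ^ 2 * (n + 1))) := by gcongr
      _ ≤ 1 / 100 := by
        rw [mul_div_assoc', div_le_div_iff₀ (by positivity) (by norm_num)]; linarith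
  have hsqpow : ∀ t : ℝ, 0 ≤ t → ((√t)⁻¹ ^ n) ^ 2 = (t ^ n)⁻¹ := by
    intro t ht
    rw [← pow_mul, mul_comm, pow_mul, inv_pow, sq_sqrt ht, inv_pow]
  have hE1 : 99 / 100 ≤ (√(1 + b ^ 2))⁻¹ ^ n := by
    refine (pow_le_pow_iff_left₀ (by norm_num) (by positivity) two_ne_zero).1 ?_
    rw [hsqpow _ (by positivity), ← inv_pow]
    have hb3 : b ^ 2 ≤ 1 / 100 := by nlinarith [sq_nonneg b]
    have h1 : 1 - b ^ 2 ≤ (1 + b ^ 2)⁻¹ := by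
      rw [← one_div, le_div_iff₀ (by positivity)]
      nlinarith [sq_nonneg (b ^ 2)]
    have h2 := one_add_mul_le_pow (a := -b ^ 2) (by linarith) n
    have h3 : (1 + -b ^ 2) ^ n ≤ ((1 + b ^ 2)⁻¹) ^ n :=
      pow_le_pow_left₀ (by linarith) (by linarith) n
    linarith
  have hE2 : (√(1 + b ^ 2 + 2 / n))⁻¹ ^ n ≤ 3 / 5 := by
    refine (pow_le_pow_iff_left₀ (by positivity) (by norm_num) two_ne_zero).1 ?_
    rw [hsqpow _ (by positivity)]
    have h1 := one_add_mul_le_pow (a := 2 / (n : ℝ))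
      (by linarith [show 0 ≤ 2 / (n : ℝ) by positivity]) n
    rw [mul_div_cancel₀ _ (by positivity)] at h1
    have h2 : (1 + 2 / (n : ℝ)) ^ n ≤ (1 + b ^ 2 + 2 / n) ^ n := by
      gcongr
      linarith [sq_nonneg b]
    calc ((1 + b ^ 2 + 2 / (n : ℝ)) ^ n)⁻¹ ≤ 3⁻¹ := inv_anti₀ (by norm_num) (by linarith)
      _ ≤ _ := by norm_num
  have hsd : √(n + 1 : ℝ) ≤ 5 / 4 * √n := by
    rw [sqrt_le_left (by positivity), mul_pow, sq_sqrt (by positivity)]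
    linarith
  have hpi : √(2 * π) ≤ 3 := by
    rw [sqrt_le_left (by norm_num)]
    linarith [pi_lt_four]
  have hpi' : (1 / 3 : ℝ) ≤ (√(2 * π))⁻¹ := by
    rw [one_div]
    exact inv_anti₀ (sqrt_pos.2 (by positivity)) hpi
  calc √(n + 1 : ℝ) / (8 * π) * b ≤ (5 / 4 * √n) / (8 * 3.14) * b := by
        gcongr; exact pi_gt_d2.le
    _ ≤ 2 / 5 * b * (1 / 3) * √n * (39 / 100) := by
        have : 0 ≤ b * √n := by positivity
        norm_num
        linarith
    _ ≤ _ := by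
        gcongr
        linarith

theorem stmt_11 (d : ℕ) (hd : 3 ≤ d)
    (μ : Measure (EuclideanSpace ℝ (Fin d))) (hμ : IsUniformOnSphere μ)
    (b : ℝ) (hb0 : 0 < b) (hb : b ≤ 1 / (10 * Real.sqrt d)) :
    μ {x | x ⟨0, by omega⟩ ∈ Set.Icc (b / 2) b} ≥
      ENNReal.ofReal (Real.sqrt d / (8 * Real.pi) * b) := by
  obtain ⟨n, rfl⟩ : ∃ n, d = n + 1 := ⟨d - 1, by omega⟩
  obtain ⟨hprob, hsphere, hinv⟩ := hμ
  push_cast at hb ⊢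
  have hb1 : b ≤ 1 := by
    have h1 : 1 ≤ √(n + 1 : ℝ) := one_le_sqrt.2 (by linarith [n.cast_nonneg (α := ℝ)])
    refine hb.trans ?_
    rw [div_le_one (by positivity)]
    linarith
  have hslab := measure_cone_le_measure_slab μ (stdGaussian (EuclideanSpace ℝ (Fin (n + 1))))
    (ae_iff.2 hsphere) hinv stdGaussian_map
    (e := EuclideanSpace.single (0 : Fin (n + 1)) (1 : ℝ)) (by simp) (b / 2) b
  simp only [EuclideanSpace.inner_single_left, EuclideanSpace.inner_single_right, map_one,
    one_mul] at hslab
  exact (ENNReal.ofReal_le_ofReal (gaussian_cone_constant_bound n (by omega) hb0 hb)).trans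
    ((gaussian_cone_lower_bound n (by omega) hb0 hb1).trans hslab)
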